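/- For every n ≥ 12 and every k with 6·π(n) ≤ k ≤ d₂(A_n), where π(n) is the number of primes at most n, the direct power (A_n)^k of the alternating group A_n is a Beauville group. -/

import Mathlib

/-- The set of elements of `G` conjugate to a power of `a`, `b` or `c`. -/
def SigmaSet {G : Type*} [Group G] (a b c : G) : Set G :=
  {g | ∃ d ∈ ({a, b, c} : Set G), ∃ m : ℤ, IsConj (d ^ m) g}

/-- `G` is an (unmixed) Beauville group. -/
def IsBeauvilleGroup (G : Type*) [Group G] : Prop :=
  ∃ a₁ b₁ c₁ a₂ b₂ c₂ : G,
    (Subgroup.closure {a₁, b₁, c₁} = ⊤ ∧ a₁ * b₁ * c₁ = 1 ∧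
      (1 : ℚ) / (orderOf a₁) + 1 / (orderOf b₁) + 1 / (orderOf c₁) < 1) ∧
    (Subgroup.closure {a₂, b₂, c₂} = ⊤ ∧ a₂ * b₂ * c₂ = 1 ∧
      (1 : ℚ) / (orderOf a₂) + 1 / (orderOf b₂) + 1 / (orderOf c₂) < 1) ∧
    SigmaSet a₁ b₁ c₁ ∩ SigmaSet a₂ b₂ c₂ = {1}

/-- `d₂ H`: the number of orbits of `Aut H` on ordered generating pairs of `H`. -/
noncomputable def d2 (H : Type*) [Group H] : ℕ :=
  Nat.card (Quot (fun p q : {p : H × H // Subgroup.closure {p.1, p.2} = ⊤} =>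
    ∃ φ : MulAut H, φ p.val.1 = q.val.1 ∧ φ p.val.2 = q.val.2))

/-- `π n`: the number of primes `p ≤ n`. -/
def primePi (n : ℕ) : ℕ := ((Finset.range (n + 1)).filter Nat.Prime).card

/-- A permutation of a finite set carries a subset with at most half of the elements off itself. -/
theorem exists_perm_apply_notMem {α : Type*} [Fintype α] [DecidableEq α] (U : Finset α)
    (hU : 2 * U.card ≤ Fintype.card α) : ∃ σ : Equiv.Perm α, ∀ i ∈ U, σ i ∉ U := by
  have hc : U.card ≤ Uᶜ.card := by rw [Finset.card_compl]; omega
  obtain ⟨V, hV, hVc⟩ := Finset.exists_subset_card_eq hc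
  have e : {x // x ∈ U} ≃ {x // x ∈ V} := Fintype.equivOfCardEq (by simp [hVc])
  refine ⟨e.extendSubtype, fun i hi => ?_⟩
  exact Finset.mem_compl.1 (hV (e.extendSubtype_mem i hi))

/-- If `s` and `k - s` are both at least `2`, then `s * (k - s) ≥ 2 * (k - 2)`. -/
theorem two_mul_sub_two_le_mul_sub {s k : ℕ} (h2 : 2 ≤ s) (hk : s + 2 ≤ k) :
    2 * (k - 2) ≤ s * (k - s) := by
  obtain ⟨t, rfl⟩ := Nat.exists_eq_add_of_le h2
  obtain ⟨r, rfl⟩ := Nat.exists_eq_add_of_le hk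
  have h1 : 2 + t + 2 + r - 2 = 2 + t + r := by omega
  have h3 : 2 + t + 2 + r - (2 + t) = 2 + r := by omega
  rw [h1, h3]
  nlinarith [Nat.zero_le (t * r)]

/-- If composing `σ` with `swap i j` makes `σ` carry `A` to `B` when it did not before,
then exactly one of `i`, `j` lies in `A`, and membership changes precisely at `i` and `j`. -/
theorem not_mem_iff_apply_mem_iff_of_mul_swap {α : Type*} [DecidableEq α]
    {A B : Finset α} {σ : Equiv.Perm α}
    {i j : α} (hn : ∃ l, ¬ (l ∈ A ↔ σ l ∈ B))
    (hs : ∀ l, l ∈ A ↔ (σ * Equiv.swap i j) l ∈ B) (l : α) :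
    (¬ (l ∈ A ↔ σ l ∈ B)) ↔ (l = i ∨ l = j) := by
  have key : ∀ l, σ l ∈ B ↔ Equiv.swap i j l ∈ A := by
    intro l
    rw [hs (Equiv.swap i j l)]
    simp
  have hi := key i
  have hj := key j
  rw [Equiv.swap_apply_left] at hi
  rw [Equiv.swap_apply_right] at hj
  have hother : ∀ m, m ≠ i → m ≠ j → (m ∈ A ↔ σ m ∈ B) := by
    intro m hmi hmj
    rw [key m, Equiv.swap_apply_of_ne_of_ne hmi hmj]
  constructor
  · intro h
    by_contra! hc
    exact h (hother l hc.1 hc.2)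
  · obtain ⟨m, hm⟩ := hn
    have hm' : m = i ∨ m = j := by
      by_contra! hc
      exact hm (hother m hc.1 hc.2)
    rintro (rfl | rfl) <;> rcases hm' with rfl | rfl <;> tauto

/-- Given at most `k / 6` families of three proper subsets of a `k`-element set, some permutation
carries no nonempty member of a family onto a member of the same family. -/
theorem exists_perm_not_mem_iff_apply_mem {α ι : Type*} [Fintype α] [DecidableEq α] [Fintype ι]
    (S : ι → Fin 3 → Finset α) (hS : ∀ p x, S p x ≠ Finset.univ)
    (h2 : 2 ≤ Fintype.card ι) (h6 : 6 * Fintype.card ι ≤ Fintype.card α) :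
    ∃ σ : Equiv.Perm α, ∀ p x y, (S p x).Nonempty → ∃ i, ¬ (i ∈ S p x ↔ σ i ∈ S p y) := by
  classical
  let T : ι × Fin 3 → Finset α := fun e =>
    Finset.univ.filter fun i => S e.1 e.2 = {i} ∨ S e.1 e.2 = {i}ᶜ
  have hT : ∀ e, (T e).card ≤ 1 := by
    intro e
    rw [Finset.card_le_one]
    intro a ha b hb
    simp only [T, Finset.mem_filter_univ] at ha hb
    have hne : ∀ a b : α, ({a} : Finset α) ≠ {b}ᶜ := by
      intro a b h
      have := congrArg Finset.card h
      rw [Finset.card_compl, Finset.card_singleton, Finset.card_singleton] at this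
      omega
    rcases ha with ha | ha <;> rcases hb with hb | hb <;> rw [ha] at hb
    · exact Finset.singleton_injective hb
    · exact absurd hb (hne _ _)
    · exact absurd hb.symm (hne _ _)
    · exact Finset.singleton_injective (compl_injective hb)
  let U : Finset α := Finset.univ.biUnion T
  have hU : 2 * U.card ≤ Fintype.card α := by
    have : U.card ≤ (Finset.univ : Finset (ι × Fin 3)).card * 1 :=
      Finset.card_biUnion_le_card_mul _ _ _ fun e _ => hT e
    rw [Finset.card_univ, Fintype.card_prod, Fintype.card_fin] at this
    omega
  obtain ⟨σ₀, hσ₀⟩ := exists_perm_apply_notMem U hU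
  have memU : ∀ p x i, (S p x = {i} ∨ S p x = {i}ᶜ) → i ∈ U := fun p x i h =>
    Finset.mem_biUnion.2 ⟨(p, x), Finset.mem_univ _, by simpa [T] using h⟩
  let P : Finset (Equiv.Perm α) := Finset.univ.filter fun σ => ∀ p x y,
    (∃ i, S p x = {i} ∨ S p x = {i}ᶜ) → ∃ i, ¬ (i ∈ S p x ↔ σ i ∈ S p y)
  have hP : P.Nonempty := by
    refine ⟨σ₀, ?_⟩
    simp only [P, Finset.mem_filter_univ]
    rintro p x y ⟨i, hi⟩
    by_contra! hb
    refine hσ₀ i (memU p x i hi) (memU p y _ ?_)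
    refine hi.imp (fun h => ?_) (fun h => ?_) <;> ext l <;>
      have hl := hb (σ₀.symm l) <;> rw [h] at hl <;>
      simpa [Equiv.symm_apply_eq] using hl.symm
  let Bad : Equiv.Perm α → Finset (ι × Fin 3 × Fin 3) := fun σ =>
    Finset.univ.filter fun e => (S e.1 e.2.1).Nonempty ∧
      ∀ i, i ∈ S e.1 e.2.1 ↔ σ i ∈ S e.1 e.2.2
  obtain ⟨σ, hσP, hσ⟩ := Finset.exists_min_image P (fun σ => (Bad σ).card) hP
  refine ⟨σ, fun p x y hne => ?_⟩
  by_contra! hbad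
  have hσP' := hσP
  simp only [P, Finset.mem_filter_univ] at hσP'
  have hsmall : ¬ ∃ i, S p x = {i} ∨ S p x = {i}ᶜ := by
    intro h
    obtain ⟨i, hi⟩ := hσP' p x y h
    exact hi (hbad i)
  have hex : ∀ q : {i // i ∈ S p x} × {j // j ∈ (S p x)ᶜ}, ∃ e : ι × Fin 3 × Fin 3,
      (∃ l, ¬ (l ∈ S e.1 e.2.1 ↔ σ l ∈ S e.1 e.2.2)) ∧
      ∀ l, l ∈ S e.1 e.2.1 ↔ (σ * Equiv.swap q.1.1 q.2.1) l ∈ S e.1 e.2.2 := by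
    rintro ⟨⟨i, hi⟩, ⟨j, hj⟩⟩
    by_contra! hno
    have hno' : ∀ p x y, (∃ l, ¬ (l ∈ S p x ↔ σ l ∈ S p y)) →
        ∃ l, ¬ (l ∈ S p x ↔ (σ * Equiv.swap i j) l ∈ S p y) := by
      intro p x y h
      obtain ⟨l, hl⟩ := hno (p, x, y) (h.imp fun l hl => by dsimp only; tauto)
      exact ⟨l, fun h => by tauto⟩
    have hτ : σ * Equiv.swap i j ∈ P := by
      simp only [P, Finset.mem_filter_univ]
      exact fun p x y h => hno' p x y (hσP' p x y h)
    have hlt : Bad (σ * Equiv.swap i j) ⊂ Bad σ := by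
      rw [Finset.ssubset_iff_of_subset]
      · refine ⟨(p, x, y), ?_, ?_⟩
        · simpa [Bad] using ⟨hne, hbad⟩
        · simp only [Bad, Finset.mem_filter_univ, not_and, not_forall]
          refine fun _ => ⟨i, ?_⟩
          have := (hbad j).symm
          rw [Finset.mem_compl] at hj
          simp only [Equiv.Perm.mul_apply, Equiv.swap_apply_left]
          tauto
      · intro e he
        simp only [Bad, Finset.mem_filter_univ] at he ⊢
        refine ⟨he.1, ?_⟩
        by_contra! hc
        obtain ⟨l, hl⟩ := hno' e.1 e.2.1 e.2.2 (hc.imp fun l h => by tauto)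
        exact hl (he.2 l)
    exact absurd (hσ _ hτ) (not_le.2 (Finset.card_lt_card hlt))
  choose f hf1 hf2 using hex
  have hinj : Function.Injective f := by
    intro q q' h
    have h1 := not_mem_iff_apply_mem_iff_of_mul_swap (hf1 q) (hf2 q)
    have h2 := not_mem_iff_apply_mem_iff_of_mul_swap (hf1 q') (hf2 q')
    rw [← h] at h2
    have h3 : ∀ l, (l = q.1.1 ∨ l = q.2.1) ↔ (l = q'.1.1 ∨ l = q'.2.1) := fun l =>
      (h1 l).symm.trans (h2 l)
    obtain ⟨⟨i, hi⟩, ⟨j, hj⟩⟩ := q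
    obtain ⟨⟨i', hi'⟩, ⟨j', hj'⟩⟩ := q'
    rw [Finset.mem_compl] at hj hj'
    have hi3 := (h3 i).1 (Or.inl rfl)
    have hj3 := (h3 j).1 (Or.inr rfl)
    have e1 : i = i' := hi3.resolve_right (by rintro rfl; exact hj' hi)
    have e2 : j = j' := hj3.resolve_left (by rintro rfl; exact hj hi')
    subst e1 e2
    rfl
  have hcard := Fintype.card_le_of_injective f hinj
  simp only [Fintype.card_prod, Fintype.card_coe, Fintype.card_fin, Finset.card_compl] at hcard
  have hc0 : 0 < (S p x).card := hne.card_pos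
  have hc1 : (S p x).card ≠ 1 := fun h => by
    obtain ⟨i, hi⟩ := Finset.card_eq_one.1 h
    exact hsmall ⟨i, Or.inl hi⟩
  have hck : (S p x)ᶜ.card ≠ 0 := by
    rw [Finset.card_ne_zero, Finset.nonempty_iff_ne_empty, Ne, Finset.compl_eq_empty_iff]
    exact hS p x
  have hck1 : (S p x)ᶜ.card ≠ 1 := fun h => by
    obtain ⟨i, hi⟩ := Finset.card_eq_one.1 h
    exact hsmall ⟨i, Or.inr (by rw [← hi, compl_compl])⟩
  rw [Finset.card_compl] at hck hck1
  have := two_mul_sub_two_le_mul_sub (s := (S p x).card) (k := Fintype.card α)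
    (by omega) (by omega)
  omega

/-- The values at `j` of the elements of `H` that are trivial on `F`. -/
def Subgroup.coordVals {ι G : Type*} [Group G] (H : Subgroup (ι → G)) (F : Finset ι) (j : ι) :
    Subgroup G where
  carrier := {s | ∃ h ∈ H, (∀ i ∈ F, h i = 1) ∧ h j = s}
  one_mem' := ⟨1, H.one_mem, fun _ _ => rfl, rfl⟩
  mul_mem' := by
    rintro _ _ ⟨h, hh, h1, rfl⟩ ⟨g, hg, g1, rfl⟩
    exact ⟨h * g, H.mul_mem hh hg, fun i hi => by simp [h1 i hi, g1 i hi], rfl⟩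
  inv_mem' := by
    rintro _ ⟨h, hh, h1, rfl⟩
    exact ⟨h⁻¹, H.inv_mem hh, fun i hi => by simp [h1 i hi], rfl⟩

theorem Subgroup.coordVals_normal {ι G : Type*} [Group G] {H : Subgroup (ι → G)}
    (hsurj : ∀ i s, ∃ h ∈ H, h i = s) (F : Finset ι) (j : ι) : (H.coordVals F j).Normal where
  conj_mem := by
    rintro _ ⟨h, hh, h1, rfl⟩ g
    obtain ⟨u, hu, rfl⟩ := hsurj j g
    exact ⟨u * h * u⁻¹, H.mul_mem (H.mul_mem hu hh) (H.inv_mem hu),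
      fun i hi => by simp [h1 i hi], rfl⟩

/-- A subgroup of a finite power of a nonabelian simple group which projects onto every factor,
and for which no two coordinates are linked by an automorphism, is the whole power. -/
theorem Subgroup.eq_top_of_pi_simple {ι G : Type*} [Finite ι] [Group G] [Finite G]
    [IsSimpleGroup G] (hcomm : ∃ s t : G, s * t * s⁻¹ * t⁻¹ ≠ 1) {H : Subgroup (ι → G)}
    (hsurj : ∀ i s, ∃ h ∈ H, h i = s)
    (hlink : ∀ i j, i ≠ j → ¬ ∃ φ : MulAut G, ∀ h ∈ H, φ (h i) = h j) : H = ⊤ := by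
  classical
  have hpair : ∀ i j, i ≠ j → H.coordVals {i} j = ⊤ := by
    intro i j hij
    refine ((Subgroup.coordVals_normal hsurj {i} j).eq_bot_or_eq_top).resolve_left fun hbot => ?_
    have htriv : ∀ h ∈ H, h i = 1 → h j = 1 := fun h hh hi => by
      have : h j ∈ H.coordVals {i} j := ⟨h, hh, by simpa using hi, rfl⟩
      rwa [hbot, Subgroup.mem_bot] at this
    choose f hf hfi using hsurj i
    have hval : ∀ h ∈ H, ∀ g ∈ H, h i = g i → h j = g j := fun h hh g hg he => by
      have := htriv (h * g⁻¹) (H.mul_mem hh (H.inv_mem hg)) (by simp [he])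
      simpa [mul_inv_eq_one] using this
    let ψ : G →* G :=
      { toFun := fun s => f s j
        map_one' := htriv _ (hf 1) (hfi 1)
        map_mul' := fun s t => hval _ (hf _) (f s * f t) (H.mul_mem (hf s) (hf t))
          (by simp [hfi]) }
    have hψ : ∀ h ∈ H, ψ (h i) = h j := fun h hh => hval _ (hf _) _ hh (hfi _)
    have hsur : Function.Surjective ψ := fun s => by
      obtain ⟨h, hh, rfl⟩ := hsurj j s
      exact ⟨h i, hψ h hh⟩
    exact hlink i j hij
      ⟨MulEquiv.ofBijective ψ (Finite.injective_iff_surjective.2 hsur |>.bijective_of_finite), hψ⟩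
  have hall : ∀ (F : Finset ι) (j : ι), j ∉ F → H.coordVals F j = ⊤ := by
    intro F j
    induction F using Finset.induction_on with
    | empty =>
      intro _
      rw [eq_top_iff]
      intro s _
      obtain ⟨h, hh, rfl⟩ := hsurj j s
      exact ⟨h, hh, by simp, rfl⟩
    | insert i F hi ih =>
      intro hj
      rw [Finset.mem_insert, not_or] at hj
      refine ((Subgroup.coordVals_normal hsurj _ j).eq_bot_or_eq_top).resolve_left fun hbot => ?_
      obtain ⟨s, t, hst⟩ := hcomm
      obtain ⟨h, hh, h1, rfl⟩ : s ∈ H.coordVals F j := by rw [ih hj.2]; trivial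
      obtain ⟨g, hg, g1, rfl⟩ : t ∈ H.coordVals {i} j := by
        rw [hpair i j (Ne.symm hj.1)]; trivial
      have : h j * g j * (h j)⁻¹ * (g j)⁻¹ ∈ H.coordVals (insert i F) j := by
        refine ⟨h * g * h⁻¹ * g⁻¹, ?_, ?_, rfl⟩
        · exact H.mul_mem (H.mul_mem (H.mul_mem hh hg) (H.inv_mem hh)) (H.inv_mem hg)
        · intro l hl
          rcases Finset.mem_insert.1 hl with rfl | hl
          · simp [g1 l (Finset.mem_singleton_self l)]
          · simp [h1 l hl]
      rw [hbot, Subgroup.mem_bot] at this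
      exact hst this
  have := Fintype.ofFinite ι
  rw [eq_top_iff]
  intro x _
  refine Subgroup.pi_mem_of_mulSingle_mem x fun i => ?_
  obtain ⟨h, hh, h1, h2⟩ : x i ∈ H.coordVals (Finset.univ.erase i) i := by
    rw [hall _ i (Finset.notMem_erase i _)]; trivial
  convert hh
  ext l : 1
  rcases eq_or_ne l i with rfl | hl
  · simp [h2]
  · simp [hl, h1 l (Finset.mem_erase.2 ⟨hl, Finset.mem_univ l⟩)]

/-- Tuples of pairwise inequivalent generating pairs generate the power of a simple group. -/
theorem closure_pair_pi_eq_top {ι G : Type*} [Finite ι] [Group G] [Finite G]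
    [IsSimpleGroup G] (hcomm : ∃ s t : G, s * t * s⁻¹ * t⁻¹ ≠ 1) (a b : ι → G)
    (hgen : ∀ i, Subgroup.closure {a i, b i} = ⊤)
    (hne : ∀ i j, i ≠ j → ¬ ∃ φ : MulAut G, φ (a i) = a j ∧ φ (b i) = b j) :
    Subgroup.closure {a, b} = ⊤ := by
  have ha : a ∈ Subgroup.closure {a, b} := Subgroup.subset_closure (by simp)
  have hb : b ∈ Subgroup.closure {a, b} := Subgroup.subset_closure (by simp)
  refine Subgroup.eq_top_of_pi_simple hcomm (fun i s => ?_) fun i j hij => ?_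
  · have : (Subgroup.closure {a, b}).map (Pi.evalMonoidHom _ i) = ⊤ := by
      rw [MonoidHom.map_closure, Set.image_pair]
      exact hgen i
    have hs : s ∈ (Subgroup.closure {a, b}).map (Pi.evalMonoidHom _ i) := by
      rw [this]; trivial
    exact hs
  · rintro ⟨φ, hφ⟩
    exact hne i j hij ⟨φ, hφ a ha, hφ b hb⟩

open Equiv Pointwise in
/-- A block of `G` is invariant under `g ∈ G` as soon as it contains `a` and `g a`. -/
theorem MulAction.IsBlock.apply_mem_iff {α : Type*} {G : Subgroup (Perm α)} {B : Set α}
    (hB : MulAction.IsBlock G B) {g : Perm α} (hg : g ∈ G) {a : α} (ha : a ∈ B) (hga : g a ∈ B)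
    (b : α) : g b ∈ B ↔ b ∈ B := by
  have h : (⟨g, hg⟩ : G) • B = B := hB.smul_eq_of_mem ha hga
  exact (congrArg (g b ∈ ·) h).to_iff.symm.trans (Set.smul_mem_smul_set_iff (a := (⟨g, hg⟩ : G)))

open Equiv in
/-- A subgroup containing the cycle `(0 1 ⋯ i)` and a `3`-cycle `(0 u v)`, where `v` is fixed by
the first cycle and all points other than `u`, `v` are at most `i`, contains the alternating
group. -/
theorem alternatingGroup_le_of_cycleRange_mem {n : ℕ} [NeZero n] {G : Subgroup (Perm (Fin n))}
    {i u v : Fin n} (hiv : i < v) (h0u : 0 ≠ u) (huv : u ≠ v)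
    (hcov : ∀ j, j ≤ i ∨ j = u ∨ j = v) (hy : Fin.cycleRange i ∈ G)
    (hx : swap 0 v * swap 0 u ∈ G) : alternatingGroup (Fin n) ≤ G := by
  have h0v : 0 ≠ v := ((Fin.zero_le i).trans_lt hiv).ne
  have hxv : (swap 0 v * swap 0 u) v = 0 := by
    rw [Perm.mul_apply, swap_apply_of_ne_of_ne h0v.symm huv.symm, swap_apply_right]
  have hxu : (swap 0 v * swap 0 u) u = v := by simp
  have hx0 : (swap 0 v * swap 0 u) 0 = u := by
    rw [Perm.mul_apply, swap_apply_left, swap_apply_of_ne_of_ne h0u.symm huv]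
  refine Perm.alternatingGroup_le_of_isPreprimitive_of_isThreeCycle_mem ?_
    (Perm.isThreeCycle_swap_mul_swap_same h0v h0u huv.symm) hx
  refine MulAction.IsPreprimitive.of_isTrivialBlock_of_notMem_fixedPoints (a := v) ?_ ?_
  · intro h
    have := h ⟨_, hx⟩
    rw [Subgroup.mk_smul, Perm.smul_def, hxv] at this
    exact h0v this
  · intro B hvB hB
    have hyv : Fin.cycleRange i v ∈ B := by rwa [Fin.cycleRange_of_gt hiv]
    have hcyc : ∀ l (hl : l < n), l ≤ i → ((⟨l, hl⟩ : Fin n) ∈ B ↔ (0 : Fin n) ∈ B) := by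
      intro l
      induction l with
      | zero => exact fun _ _ => Iff.rfl
      | succ l ih =>
        intro hl hli
        rw [← ih (by omega) (by omega), ← hB.apply_mem_iff hy hvB hyv ⟨l, by omega⟩]
        have : Fin.cycleRange i ⟨l, by omega⟩ = ⟨l + 1, hl⟩ := by
          ext
          rw [Fin.coe_cycleRange_of_lt (show (⟨l, by omega⟩ : Fin n) < i from hli)]
        rw [this]
    by_cases h0 : (0 : Fin n) ∈ B
    · right
      have huB : u ∈ B := by
        rw [← hx0, hB.apply_mem_iff hx hvB (by rwa [hxv])]
        exact h0
      refine Set.eq_univ_of_forall fun j => ?_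
      rcases hcov j with hj | rfl | rfl
      · exact (hcyc j j.2 hj).2 h0
      · exact huB
      · exact hvB
    · left
      have huB : u ∉ B := fun huB => h0 <| by
        rw [← hxv, hB.apply_mem_iff hx huB (by rwa [hxu])]
        exact hvB
      have hsub : ∀ j ∈ B, j = v := by
        intro j hj
        rcases hcov j with hj' | rfl | rfl
        · exact absurd ((hcyc j j.2 hj').1 hj) h0
        · exact absurd hj huB
        · rfl
      exact fun a ha b hb => (hsub a ha).trans (hsub b hb).symm

open Equiv in
/-- If a subgroup containing `x` and `y` contains the alternating group, then `x` and `y`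
generate the alternating group. -/
theorem closure_pair_alternatingGroup_eq_top {α : Type*} [Fintype α] [DecidableEq α]
    {x y : alternatingGroup α}
    (h : alternatingGroup α ≤ Subgroup.closure {(x : Perm α), (y : Perm α)}) :
    Subgroup.closure {x, y} = ⊤ := by
  have hmap : (Subgroup.closure {x, y}).map (alternatingGroup α).subtype =
      Subgroup.closure {(x : Perm α), (y : Perm α)} := by
    rw [MonoidHom.map_closure, Set.image_pair]
    rfl
  rw [eq_top_iff]
  intro g _
  have hg : (g : Perm α) ∈ (Subgroup.closure {x, y}).map (alternatingGroup α).subtype := by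
    rw [hmap]
    exact h g.2
  obtain ⟨g', hg', he⟩ := hg
  exact Subtype.ext he ▸ hg'

open Equiv in
/-- The alternating group is generated by a `3`-cycle `x` and an element `y` of order at least `4`
such that `3` does not divide the orders of both `y` and `x * y`. -/
theorem exists_perm_pair {n : ℕ} (hn : 12 ≤ n) : ∃ x y : Perm (Fin n),
    x ∈ alternatingGroup (Fin n) ∧ y ∈ alternatingGroup (Fin n) ∧
    alternatingGroup (Fin n) ≤ Subgroup.closure {x, y} ∧ orderOf x = 3 ∧ 4 ≤ orderOf y ∧
    (¬ 3 ∣ orderOf y ∨ ¬ 3 ∣ orderOf (x * y)) := by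
  have : NeZero n := ⟨by omega⟩
  have key : ∀ i u v : Fin n, Even (i : ℕ) → 3 ≤ (i : ℕ) → i < v → 0 ≠ u → u ≠ v →
      (∀ j, j ≤ i ∨ j = u ∨ j = v) →
      (¬ 3 ∣ (i : ℕ) + 1 ∨ ¬ 3 ∣ orderOf (swap 0 v * swap 0 u * Fin.cycleRange i)) →
      ∃ x y : Perm (Fin n), x ∈ alternatingGroup (Fin n) ∧ y ∈ alternatingGroup (Fin n) ∧
        alternatingGroup (Fin n) ≤ Subgroup.closure {x, y} ∧ orderOf x = 3 ∧ 4 ≤ orderOf y ∧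
        (¬ 3 ∣ orderOf y ∨ ¬ 3 ∣ orderOf (x * y)) := by
    intro i u v heven h3 hiv h0u huv hcov hord
    have h0v : 0 ≠ v := ((Fin.zero_le i).trans_lt hiv).ne
    have h3c := Perm.isThreeCycle_swap_mul_swap_same h0v h0u huv.symm
    have hi0 : i ≠ 0 := by
      rintro rfl
      simp at h3
    have hoy : orderOf (Fin.cycleRange i) = i + 1 := by
      rw [← Perm.lcm_cycleType, Fin.cycleType_cycleRange hi0, Multiset.lcm_singleton]
      simp
    refine ⟨swap 0 v * swap 0 u, Fin.cycleRange i, h3c.mem_alternatingGroup, ?_,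
      alternatingGroup_le_of_cycleRange_mem hiv h0u huv hcov
        (Subgroup.subset_closure (by simp)) (Subgroup.subset_closure (by simp)),
      h3c.orderOf, by omega, by rwa [hoy]⟩
    rw [Perm.mem_alternatingGroup, Fin.sign_cycleRange, heven.neg_one_pow]
  rcases Nat.even_or_odd n with hp | hp
  · let i : Fin n := ⟨n - 2, by omega⟩
    let v : Fin n := ⟨n - 1, by omega⟩
    let o : Fin n := ⟨1, by omega⟩
    refine key i o v (by simp only [i]; grind) (by simp only [i]; omega)
      (Fin.lt_def.2 (by simp only [i, v]; omega)) (by simp [o, Fin.ext_iff])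
      (by simp only [o, v, ne_eq, Fin.mk.injEq]; omega) ?_ ?_
    · intro j
      simp only [i, o, v, Fin.ext_iff, Fin.le_def]
      omega
    · have hoi : o < i := Fin.lt_def.2 (by simp only [o, i]; omega)
      have hiv : i < v := Fin.lt_def.2 (by simp only [i, v]; omega)
      have hw : swap 0 o * Fin.cycleRange i = Fin.cycleIcc o i := by
        have hs : swap 0 o = Fin.cycleIcc 0 o := by
          ext k
          rcases lt_trichotomy k o with hk | rfl | hk
          · have : k = 0 := Fin.ext (Nat.lt_one_iff.1 hk)
            subst this
            rw [swap_apply_left, Fin.cycleIcc_of_ge_of_lt le_rfl hk,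
              Fin.val_add_one_of_lt' (by simp; omega)]
            rfl
          · rw [swap_apply_right, Fin.cycleIcc_of_last (Fin.zero_le _)]
          · rw [Fin.cycleIcc_of_gt hk, swap_apply_of_ne_of_ne
              ((Fin.zero_le o).trans_lt hk).ne' hk.ne']
        rw [← Fin.cycleIcc_zero_eq_cycleRange, ← mul_right_inj (swap 0 o), ← mul_assoc,
          swap_mul_self, one_mul, hs]
        exact DFunLike.coe_injective (Fin.cycleIcc.trans (Fin.zero_le _) hoi.le).symm
      have hdisj : Perm.Disjoint (swap 0 v) (Fin.cycleIcc o i) := by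
        intro k
        by_cases hk0 : k = 0
        · exact Or.inr (by rw [hk0, Fin.cycleIcc_of_lt (Fin.lt_def.2 (by simp [o]))])
        by_cases hkv : k = v
        · exact Or.inr (by rw [hkv, Fin.cycleIcc_of_gt hiv])
        · exact Or.inl (swap_apply_of_ne_of_ne hk0 hkv)
      have hpow : (swap 0 v * swap 0 o * Fin.cycleRange i) ^ (n - 2) = 1 := by
        have h2 : 2 ∣ n - 2 := by grind
        rw [mul_assoc, hw, hdisj.commute.mul_pow]
        have e1 : (swap 0 v) ^ (n - 2) = 1 :=
          orderOf_dvd_iff_pow_eq_one.1 ((orderOf_dvd_of_pow_eq_one (by simp [sq])).trans h2)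
        have e2 : (Fin.cycleIcc o i) ^ (n - 2) = 1 := by
          rw [← orderOf_dvd_iff_pow_eq_one, ← Perm.lcm_cycleType,
            Fin.cycleType_cycleIcc_of_lt hoi, Multiset.lcm_singleton]
          simp only [i, o, normalize_eq]
          rw [show n - 2 - 1 + 1 = n - 2 by omega]
        rw [e1, e2, one_mul]
      have hdvd := orderOf_dvd_of_pow_eq_one hpow
      by_contra! hc
      have h1 := hc.2.trans hdvd
      have h2 := hc.1
      simp only [i] at h2
      omega
  · let i : Fin n := ⟨n - 3, by omega⟩
    let u : Fin n := ⟨n - 2, by omega⟩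
    let v : Fin n := ⟨n - 1, by omega⟩
    refine key i u v (by simp only [i]; grind) (by simp only [i]; omega)
      (Fin.lt_def.2 (by simp only [i, v]; omega)) (by simp [u, Fin.ext_iff]; omega)
      (by simp only [u, v, ne_eq, Fin.mk.injEq]; omega) ?_ ?_
    · intro j
      simp only [i, u, v, Fin.ext_iff, Fin.le_def]
      omega
    · have hw : swap 0 v * swap 0 u * Fin.cycleRange i = finRotate n := by
        have hiv : i < v := Fin.lt_def.2 (by simp only [i, v]; omega)
        have hiu : i < u := Fin.lt_def.2 (by simp only [i, u]; omega)
        have huv : u < v := Fin.lt_def.2 (by simp only [u, v]; omega)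
        have h0u : (0 : Fin n) ≠ u := ((Fin.zero_le i).trans_lt hiu).ne
        have h0v : (0 : Fin n) ≠ v := ((Fin.zero_le i).trans_lt hiv).ne
        ext k
        obtain ⟨m, rfl⟩ : ∃ m, n = m + 1 := ⟨n - 1, by omega⟩
        rw [coe_finRotate, Perm.mul_apply, Perm.mul_apply]
        rcases lt_trichotomy k i with hk | rfl | hk
        · have hk1 : (Fin.cycleRange i k : ℕ) = k + 1 := Fin.coe_cycleRange_of_lt hk
          have hk' : (k : ℕ) < m - 2 := hk
          have hz : ((0 : Fin (m + 1)) : ℕ) = 0 := rfl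
          rw [swap_apply_of_ne_of_ne (b := u) (x := Fin.cycleRange i k),
            swap_apply_of_ne_of_ne, hk1, if_neg] <;>
            simp only [Fin.ext_iff, ne_eq, hk1, u, v, Fin.val_last, hz] <;> omega
        · rw [Fin.cycleRange_self, swap_apply_left, swap_apply_of_ne_of_ne h0u.symm huv.ne, if_neg]
          · simp only [i, u]; omega
          · simp only [Fin.ext_iff, i, Fin.val_last]; omega
        · rw [Fin.cycleRange_of_gt hk]
          obtain rfl | rfl : k = u ∨ k = v := by
            have hk' : m + 1 - 3 < (k : ℕ) := hk
            simp only [u, v, Fin.ext_iff]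
            omega
          · rw [swap_apply_right, swap_apply_left, if_neg]
            · simp only [u, v]; omega
            · simp only [Fin.ext_iff, u, Fin.val_last]; omega
          · rw [swap_apply_of_ne_of_ne h0v.symm huv.ne', swap_apply_right, if_pos]
            · rfl
            · simp only [Fin.ext_iff, v, Fin.val_last]; omega
      by_contra! hc
      rw [hw, ← Perm.lcm_cycleType, cycleType_finRotate_of_le (by omega),
        Multiset.lcm_singleton] at hc
      simp only [i, normalize_eq] at hc
      omega

/-- The coordinates at which the elements of prime order `p` in `⟨w⟩` are nontrivial. -/
noncomputable def primeSupport {ι G : Type*} [Fintype ι] [Group G] (p : ℕ) (w : ι → G) :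
    Finset ι := by
  classical
  exact if p ∣ orderOf w then Finset.univ.filter fun i => w i ^ (orderOf w / p) ≠ 1 else ∅

theorem mem_primeSupport_iff {ι G : Type*} [Fintype ι] [Group G] {p : ℕ} {w : ι → G} {i : ι} :
    i ∈ primeSupport p w ↔ p ∣ orderOf w ∧ w i ^ (orderOf w / p) ≠ 1 := by
  classical
  unfold primeSupport
  split_ifs with h <;> simp [h]

theorem primeSupport_ne_univ {ι G : Type*} [Fintype ι] [Group G] {p : ℕ}
    (hp : p.Prime) {w : ι → G} (h : ∃ i, ¬ p ∣ orderOf (w i)) :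
    primeSupport p w ≠ Finset.univ := by
  obtain ⟨i, hi⟩ := h
  intro hu
  have hmem : i ∈ primeSupport p w := hu ▸ Finset.mem_univ i
  rw [mem_primeSupport_iff] at hmem
  refine hmem.2 (orderOf_dvd_iff_pow_eq_one.1 ?_)
  have h1 : orderOf (w i) ∣ orderOf w := orderOf_map_dvd (Pi.evalMonoidHom _ i) w
  rw [← Nat.div_mul_cancel hmem.1] at h1
  exact (((Nat.Prime.coprime_iff_not_dvd hp).2 hi).symm).dvd_of_dvd_mul_right h1

/-- A power of prime order `p` of `w` is nontrivial exactly on `primeSupport p w`. -/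
theorem zpow_apply_ne_one_iff_mem_primeSupport {ι G : Type*} [Fintype ι] [Group G] [Finite G]
    {p : ℕ} (hp : p.Prime) {w : ι → G} {m : ℤ} (hm : orderOf (w ^ m) = p) (i : ι) :
    (w ^ m) i ≠ 1 ↔ i ∈ primeSupport p w := by
  obtain ⟨M, hM⟩ : ∃ M : ℕ, w ^ M = w ^ m :=
    mem_powers_iff_mem_zpowers.2 (Subgroup.zpow_mem_zpowers w m)
  rw [← hM] at hm ⊢
  have hpd : p ∣ orderOf w := hm ▸ orderOf_pow_dvd M
  obtain ⟨N, hN⟩ := hpd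
  have hdiv : orderOf w / p = N := by rw [hN, Nat.mul_div_cancel_left _ hp.pos]
  have hpM : p * N ∣ p * M := by
    rw [← hN]
    refine orderOf_dvd_of_pow_eq_one ?_
    rw [mul_comm, pow_mul, ← hm, pow_orderOf_eq_one]
  obtain ⟨t, rfl⟩ := Nat.dvd_of_mul_dvd_mul_left hp.pos hpM
  have hpt : p.Coprime t := by
    rw [Nat.Prime.coprime_iff_not_dvd hp]
    rintro ⟨r, rfl⟩
    refine hp.one_lt.ne' (hm.symm.trans ?_)
    rw [orderOf_eq_one_iff, ← orderOf_dvd_iff_pow_eq_one, hN]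
    exact ⟨r, by ring⟩
  rw [mem_primeSupport_iff, hdiv, not_iff_comm, not_and_not_right]
  simp only [hN, dvd_mul_right, true_implies, Pi.pow_apply]
  constructor
  · intro h
    rw [pow_mul, h, one_pow]
  · intro h
    have h1 : orderOf (w i ^ N) ∣ t := orderOf_dvd_of_pow_eq_one (by rw [← pow_mul, h])
    have h2 : orderOf (w i ^ N) ∣ p := by
      refine orderOf_dvd_of_pow_eq_one ?_
      rw [← pow_mul, mul_comm, ← hN, ← Pi.pow_apply, pow_orderOf_eq_one, Pi.one_apply]
    exact orderOf_eq_one_iff.1 (Nat.eq_one_of_dvd_coprimes hpt h2 h1)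

theorem orderOf_comp_perm {ι G : Type*} [Group G] (w : ι → G) (σ : Equiv.Perm ι) :
    orderOf (w ∘ σ) = orderOf w := by
  rw [orderOf_eq_orderOf_iff]
  intro n
  simp only [funext_iff, Pi.pow_apply, Function.comp_apply, Pi.one_apply]
  exact σ.forall_congr_left.trans (by simp)

theorem mem_primeSupport_comp_perm {ι G : Type*} [Fintype ι] [Group G] {p : ℕ} (w : ι → G)
    (σ : Equiv.Perm ι) (i : ι) : i ∈ primeSupport p (w ∘ σ) ↔ σ i ∈ primeSupport p w := by
  rw [mem_primeSupport_iff, mem_primeSupport_iff, orderOf_comp_perm, Function.comp_apply]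

/-- If `g` in the set `Σ` of a triple has prime order `p`, then it is nontrivial exactly on the
`p`-support of one of the three elements. -/
theorem exists_primeSupport_of_mem_sigmaSet {ι G : Type*} [Fintype ι] [Group G] [Finite G]
    {v : Fin 3 → ι → G} {g : ι → G} (hg : g ∈ SigmaSet (v 0) (v 1) (v 2)) {p : ℕ}
    (hp : p.Prime) (hgp : orderOf g = p) : ∃ x, ∀ i, g i ≠ 1 ↔ i ∈ primeSupport p (v x) := by
  obtain ⟨d, hd, m, hc⟩ := hg
  obtain ⟨x, rfl⟩ : ∃ x, d = v x := by
    rcases hd with h | h | h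
    exacts [⟨0, h⟩, ⟨1, h⟩, ⟨2, h⟩]
  refine ⟨x, fun i => ?_⟩
  have hord : orderOf (v x ^ m) = p := by
    obtain ⟨c, hc⟩ := isConj_iff.1 hc
    rw [← hgp, ← hc]
    exact (MulEquiv.orderOf_eq (MulAut.conj c) (v x ^ m)).symm
  rw [← zpow_apply_ne_one_iff_mem_primeSupport hp hord i, not_iff_not]
  obtain ⟨c, rfl⟩ := isConj_iff.1 hc
  simp

theorem pow_mem_sigmaSet {G : Type*} [Group G] {a b c g : G} (hg : g ∈ SigmaSet a b c) (l : ℕ) :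
    g ^ l ∈ SigmaSet a b c := by
  obtain ⟨d, hd, m, hc⟩ := hg
  refine ⟨d, hd, m * l, ?_⟩
  rw [zpow_mul, zpow_natCast]
  exact hc.pow l

theorem sum_one_div_lt_one {a b c : ℕ} (ha : 4 ≤ a) (hb : 4 ≤ b) (hc : 4 ≤ c) :
    (1 : ℚ) / a + 1 / b + 1 / c < 1 := by
  have h : ∀ n : ℕ, 4 ≤ n → (1 : ℚ) / n ≤ 1 / 4 := fun n hn =>
    one_div_le_one_div_of_le (by norm_num) (by exact_mod_cast hn)
  linarith [h a ha, h b hb, h c hc]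

/-- `k`-tuples of pairwise inequivalent generating triples of a simple group give a hyperbolic
generating triple of the `k`-th power. -/
theorem pi_triple_generates {ι G : Type*} [Finite ι] [Group G] [Finite G] [IsSimpleGroup G]
    (hcomm : ∃ s t : G, s * t * s⁻¹ * t⁻¹ ≠ 1) (v : Fin 3 → ι → G)
    (hv : ∀ i, v 0 i * v 1 i * v 2 i = 1)
    (hgen : ∀ i, Subgroup.closure {v 0 i, v 1 i} = ⊤)
    (hne : ∀ i j, i ≠ j → ¬ ∃ φ : MulAut G, φ (v 0 i) = v 0 j ∧ φ (v 1 i) = v 1 j)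
    (hord : ∀ x, ∃ i, 4 ≤ orderOf (v x i)) :
    Subgroup.closure {v 0, v 1, v 2} = ⊤ ∧ v 0 * v 1 * v 2 = 1 ∧
      (1 : ℚ) / (orderOf (v 0)) + 1 / (orderOf (v 1)) + 1 / (orderOf (v 2)) < 1 := by
  refine ⟨?_, funext hv, ?_⟩
  · rw [eq_top_iff, ← closure_pair_pi_eq_top hcomm (v 0) (v 1) hgen hne]
    exact Subgroup.closure_mono (by grind)
  · have h : ∀ x, 4 ≤ orderOf (v x) := fun x => by
      obtain ⟨i, hi⟩ := hord x
      have hd : orderOf (v x i) ∣ orderOf (v x) := orderOf_map_dvd (Pi.evalMonoidHom _ i) (v x)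
      exact hi.trans (Nat.le_of_dvd (orderOf_pos _) hd)
    exact sum_one_div_lt_one (h 0) (h 1) (h 2)

/-- Sufficiently large powers of a finite simple group are Beauville, given a tuple of pairwise
inequivalent generating triples whose orders are suitably coprime. -/
theorem isBeauvilleGroup_pi {ι G : Type*} [Fintype ι] [Group G] [Finite G] [IsSimpleGroup G]
    (hcomm : ∃ s t : G, s * t * s⁻¹ * t⁻¹ ≠ 1) {P : Finset ℕ} (hprime : ∀ p ∈ P, p.Prime)
    (hP : ∀ p, p.Prime → p ∣ Nat.card G → p ∈ P) (hP2 : 2 ≤ P.card)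
    (hk : 6 * P.card ≤ Fintype.card ι) (v : Fin 3 → ι → G)
    (hv : ∀ i, v 0 i * v 1 i * v 2 i = 1)
    (hgen : ∀ i, Subgroup.closure {v 0 i, v 1 i} = ⊤)
    (hne : ∀ i j, i ≠ j → ¬ ∃ φ : MulAut G, φ (v 0 i) = v 0 j ∧ φ (v 1 i) = v 1 j)
    (hord : ∀ x, ∃ i, 4 ≤ orderOf (v x i))
    (hcop : ∀ p, p.Prime → ∀ x, ∃ i, ¬ p ∣ orderOf (v x i)) :
    IsBeauvilleGroup (ι → G) := by
  classical
  obtain ⟨σ, hσ⟩ := exists_perm_not_mem_iff_apply_mem (ι := {p // p ∈ P})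
    (fun p x => primeSupport p (v x))
    (fun p x => primeSupport_ne_univ (hprime p p.2) (hcop p (hprime p p.2) x))
    (by rwa [Fintype.card_coe]) (by rwa [Fintype.card_coe])
  let v' : Fin 3 → ι → G := fun x => v x ∘ σ
  refine ⟨v 0, v 1, v 2, v' 0, v' 1, v' 2, pi_triple_generates hcomm v hv hgen hne hord,
    pi_triple_generates hcomm v' (fun i => hv _) (fun i => hgen _)
      (fun i j hij => hne _ _ (σ.injective.ne hij))
      (fun x => (hord x).imp' σ.symm fun i hi => by simpa [v'] using hi), ?_⟩
  refine Set.Subset.antisymm ?_ ?_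
  · rintro g ⟨hg1, hg2⟩
    by_contra hg
    rw [Set.mem_singleton_iff, ← orderOf_eq_one_iff] at hg
    have hp := Nat.minFac_prime hg
    set p := (orderOf g).minFac
    have hdvd : p ∣ orderOf g := Nat.minFac_dvd _
    have hgp : orderOf (g ^ (orderOf g / p)) = p :=
      orderOf_pow_orderOf_div (orderOf_pos g).ne' hdvd
    have hpP : p ∈ P := by
      refine hP p hp (hp.dvd_of_dvd_pow (n := Nat.card ι) ?_)
      have := hdvd.trans (orderOf_dvd_natCard g)
      rwa [Nat.card_fun] at this
    obtain ⟨x, hx⟩ := exists_primeSupport_of_mem_sigmaSet (pow_mem_sigmaSet hg1 _) hp hgp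
    obtain ⟨y, hy⟩ := exists_primeSupport_of_mem_sigmaSet (pow_mem_sigmaSet hg2 _) hp hgp
    have hne1 : g ^ (orderOf g / p) ≠ 1 := by
      rw [Ne, ← orderOf_eq_one_iff, hgp]
      exact hp.one_lt.ne'
    obtain ⟨j, hj⟩ := Function.ne_iff.1 hne1
    obtain ⟨i, hi⟩ := hσ ⟨p, hpP⟩ x y ⟨j, (hx j).1 hj⟩
    exact hi ((hx i).symm.trans ((hy i).trans (mem_primeSupport_comp_perm (v y) σ i)))
  · rintro _ rfl
    exact ⟨⟨v 0, by simp, 0, by simp⟩, ⟨v' 0, by simp, 0, by simp⟩⟩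

/-- The three elements `x`, `y`, `(x * y)⁻¹` of the triple attached to a pair. -/
def tripleOfPair {H : Type*} [Group H] (q : H × H) : Fin 3 → H := ![q.1, q.2, (q.1 * q.2)⁻¹]

/-- A finite simple group with a suitable generating pair has Beauville powers. -/
theorem isBeauvilleGroup_pi_of_pair {G : Type*} [Group G] [Finite G] [IsSimpleGroup G]
    (hcomm : ∃ s t : G, s * t * s⁻¹ * t⁻¹ ≠ 1) {P : Finset ℕ} (hprime : ∀ p ∈ P, p.Prime)
    (hP : ∀ p, p.Prime → p ∣ Nat.card G → p ∈ P) (hP2 : 2 ≤ P.card)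
    {k : ℕ} (hk : 6 * P.card ≤ k) (hk2 : k ≤ d2 G) {x y : G}
    (hxy : Subgroup.closure {x, y} = ⊤)
    (hord : ∃ w ∈ ({x, y, x * y} : Set G), 4 ≤ orderOf w)
    (hcop : ∀ p, p.Prime → ∃ w ∈ ({x, y, x * y} : Set G), ¬ p ∣ orderOf w) :
    IsBeauvilleGroup (Fin k → G) := by
  classical
  let r := fun p q : {p : G × G // Subgroup.closure {p.1, p.2} = ⊤} =>
    ∃ φ : MulAut G, φ p.val.1 = q.val.1 ∧ φ p.val.2 = q.val.2
  have : Fintype (Quot r) := Fintype.ofFinite _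
  let ord : Fin 3 → Quot r → ℕ := fun m => Quot.lift (fun q => orderOf (tripleOfPair q.1 m)) <| by
    rintro p q ⟨φ, h1, h2⟩
    have : tripleOfPair q.1 m = φ (tripleOfPair p.1 m) := by
      fin_cases m <;> simp [tripleOfPair, ← h1, ← h2]
    simp only [this, MulEquiv.orderOf_eq]
  have ord_out : ∀ m q, orderOf (tripleOfPair q.out.1 m) = ord m q := fun m q =>
    congrArg (ord m) (Quot.out_eq q)
  have hyz : Subgroup.closure {y, (x * y)⁻¹} = ⊤ := by
    rw [eq_top_iff, ← hxy, Subgroup.closure_le]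
    have hy : y ∈ Subgroup.closure {y, (x * y)⁻¹} := Subgroup.subset_closure (by simp)
    have hz : (x * y)⁻¹ ∈ Subgroup.closure {y, (x * y)⁻¹} := Subgroup.subset_closure (by simp)
    have hx := Subgroup.inv_mem _ (Subgroup.mul_mem _ hy hz)
    rw [show (y * (x * y)⁻¹)⁻¹ = x by group] at hx
    rintro _ (rfl | rfl)
    exacts [hx, hy]
  have hzx : Subgroup.closure {(x * y)⁻¹, x} = ⊤ := by
    rw [eq_top_iff, ← hxy, Subgroup.closure_le]
    have hx : x ∈ Subgroup.closure {(x * y)⁻¹, x} := Subgroup.subset_closure (by simp)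
    have hz : (x * y)⁻¹ ∈ Subgroup.closure {(x * y)⁻¹, x} := Subgroup.subset_closure (by simp)
    have hy := Subgroup.inv_mem _ (Subgroup.mul_mem _ hz hx)
    rw [show ((x * y)⁻¹ * x)⁻¹ = y by group] at hy
    rintro _ (rfl | rfl)
    exacts [hx, hy]
  let q : Fin 3 → Quot r :=
    ![Quot.mk r ⟨(x, y), hxy⟩, Quot.mk r ⟨(y, (x * y)⁻¹), hyz⟩, Quot.mk r ⟨((x * y)⁻¹, x), hzx⟩]
  have hB : (Finset.univ.image q).card ≤ k := by
    have : (Finset.univ.image q).card ≤ 3 := Finset.card_image_le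
    omega
  obtain ⟨T, hBT, -, hTk⟩ := Finset.exists_subsuperset_card_eq (Finset.subset_univ _) hB
    (by rw [Finset.card_univ, ← Nat.card_eq_fintype_card]; exact hk2)
  let e : T ≃ Fin k := T.equivFinOfCardEq hTk
  let v : Fin 3 → Fin k → G := fun m i => tripleOfPair (e.symm i).1.out.1 m
  have hval : ∀ m, ∀ w ∈ ({x, y, x * y} : Set G), ∃ i, orderOf (v m i) = orderOf w := by
    intro m w hw
    obtain ⟨j, hj⟩ : ∃ j, ord m (q j) = orderOf w := by
      have hz := orderOf_inv (x * y)
      have h1 : (y * (x * y)⁻¹)⁻¹ = x := by group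
      have h2 : ((x * y)⁻¹ * x)⁻¹ = y := by group
      rcases hw with h | h | h <;> rw [h] <;> fin_cases m
      exacts [⟨0, rfl⟩, ⟨2, rfl⟩, ⟨1, congrArg orderOf h1⟩,
        ⟨1, rfl⟩, ⟨0, rfl⟩, ⟨2, congrArg orderOf h2⟩, ⟨2, hz⟩, ⟨1, hz⟩, ⟨0, hz⟩]
    refine ⟨e ⟨q j, hBT (Finset.mem_image_of_mem q (Finset.mem_univ j))⟩, ?_⟩
    simp only [v, Equiv.symm_apply_apply]
    rw [ord_out, hj]
  refine isBeauvilleGroup_pi hcomm hprime hP hP2 (by simpa using hk) v ?_ ?_ ?_ ?_ ?_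
  · intro i
    simp [v, tripleOfPair]
  · exact fun i => (e.symm i).1.out.2
  · intro i j hij hφ
    have : Quot.mk r (e.symm i).1.out = Quot.mk r (e.symm j).1.out := Quot.sound hφ
    rw [Quot.out_eq, Quot.out_eq] at this
    exact hij (e.symm.injective (Subtype.ext this))
  · intro m
    obtain ⟨w, hw, h⟩ := hord
    obtain ⟨i, hi⟩ := hval m w hw
    exact ⟨i, hi ▸ h⟩
  · intro p hp m
    obtain ⟨w, hw, h⟩ := hcop p hp
    obtain ⟨i, hi⟩ := hval m w hw
    exact ⟨i, hi ▸ h⟩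

theorem An_power_beauville_large_k (n k : ℕ) (hn : 12 ≤ n)
    (hk1 : 6 * primePi n ≤ k) (hk2 : k ≤ d2 (alternatingGroup (Fin n))) :
    IsBeauvilleGroup (Fin k → alternatingGroup (Fin n)) := by
  obtain ⟨x, y, hx, hy, hgen, hox, hoy, h3⟩ := exists_perm_pair hn
  have : IsSimpleGroup (alternatingGroup (Fin n)) :=
    alternatingGroup.isSimpleGroup (by rw [Nat.card_fin]; omega)
  have hgen' := closure_pair_alternatingGroup_eq_top (x := ⟨x, hx⟩) (y := ⟨y, hy⟩) hgen
  refine isBeauvilleGroup_pi_of_pair (P := (Finset.range (n + 1)).filter Nat.Prime) ?_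
    (fun p hp => (Finset.mem_filter.1 hp).2) ?_ ?_ hk1 hk2 hgen' ?_ ?_
  · by_contra! hc
    have hmem : (⟨x, hx⟩ : alternatingGroup (Fin n)) ∈ Subgroup.center _ :=
      Subgroup.mem_center_iff.2 fun g => mul_inv_eq_iff_eq_mul.1 (mul_inv_eq_one.1 (hc g _))
    rw [alternatingGroup.center_eq_bot (by rw [Nat.card_fin]; omega), Subgroup.mem_bot,
      ← orderOf_eq_one_iff, Subgroup.orderOf_mk, hox] at hmem
    omega
  · intro p hp hd
    have hd' := hd.trans (Subgroup.card_subgroup_dvd_card (alternatingGroup (Fin n)))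
    rw [Nat.card_perm, Nat.card_fin, hp.dvd_factorial] at hd'
    rw [Finset.mem_filter, Finset.mem_range]
    exact ⟨by omega, hp⟩
  · have : ({2, 3} : Finset ℕ) ⊆ (Finset.range (n + 1)).filter Nat.Prime := by
      intro p hp
      simp only [Finset.mem_insert, Finset.mem_singleton] at hp
      rw [Finset.mem_filter, Finset.mem_range]
      rcases hp with rfl | rfl
      exacts [⟨by omega, Nat.prime_two⟩, ⟨by omega, Nat.prime_three⟩]
    exact (Finset.card_le_card this).trans' (by decide)
  · exact ⟨⟨y, hy⟩, by simp, by rwa [Subgroup.orderOf_mk]⟩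
  · intro p hp
    by_cases h : p = 3
    · subst h
      rcases h3 with h | h
      · exact ⟨⟨y, hy⟩, by simp, by rwa [Subgroup.orderOf_mk]⟩
      · exact ⟨⟨x, hx⟩ * ⟨y, hy⟩, by simp, by rwa [MulMemClass.mk_mul_mk, Subgroup.orderOf_mk]⟩
    · refine ⟨⟨x, hx⟩, by simp, ?_⟩
      rw [Subgroup.orderOf_mk, hox]
      exact fun hd => h ((Nat.prime_dvd_prime_iff_eq hp Nat.prime_three).1 hd)
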